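/- arXiv:2210.10714 — 7 statements merged into one kernel-verified Lean document; each statement's English description precedes it below -/
import Mathlib

section
/- Let (xₙ) be a sequence generated by the inertial proximal algorithm (IPA). Then for every n ≥ 1 and every x ∈ K: ‖x_{n+1} − x‖² − (1+α)‖xₙ − x‖² + α‖x_{n−1} − x‖² ≤ (α − 1)‖x_{n+1} − xₙ‖² + 2α‖xₙ − x_{n−1}‖² + 2λₙβₙ f(x_{n+1}, x) + 2λₙ g(x_{n+1}, x). -/
set_option autoImplicit false

open RealInnerProductSpace

theorem stmt1 {H : Type*} [NormedAddCommGroup H] [InnerProductSpace ℝ H] [CompleteSpace H]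
    (K : Set H) (hKne : K.Nonempty) (hKcl : IsClosed K) (hKcv : Convex ℝ K)
    (f g : H → H → ℝ) (α : ℝ) (hα0 : 0 ≤ α) (hα1 : α ≤ 1)
    (lam beta : ℕ → ℝ) (hlam : ∀ n, 0 < lam n) (hbeta : ∀ n, 0 < beta n)
    (x : ℕ → H) (hxK : ∀ n, x n ∈ K)
    (hIPA : ∀ n, 1 ≤ n → ∀ y ∈ K,
      0 ≤ beta n * f (x (n + 1)) y + g (x (n + 1)) y +
        (1 / lam n) * ⟪x (n + 1) - (x n + α • (x n - x (n - 1))), y - x (n + 1)⟫) :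
    ∀ n, 1 ≤ n → ∀ z ∈ K,
      ‖x (n + 1) - z‖ ^ 2 - (1 + α) * ‖x n - z‖ ^ 2 + α * ‖x (n - 1) - z‖ ^ 2 ≤
        (α - 1) * ‖x (n + 1) - x n‖ ^ 2 + 2 * α * ‖x n - x (n - 1)‖ ^ 2
        + 2 * lam n * beta n * f (x (n + 1)) z + 2 * lam n * g (x (n + 1)) z := by
  intro n hn z hz
  have h := hIPA n hn z hz
  have hl := hlam n
  have h2 : 0 ≤ lam n * (beta n * f (x (n + 1)) z + g (x (n + 1)) z) +
      ⟪x (n + 1) - (x n + α • (x n - x (n - 1))), z - x (n + 1)⟫ := by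
    have h3 := mul_nonneg hl.le h
    rw [mul_add, ← mul_assoc (lam n) (1 / lam n), mul_one_div_cancel hl.ne', one_mul] at h3
    exact h3
  obtain ⟨a, ha⟩ : ∃ a, a = x (n + 1) - z := ⟨_, rfl⟩
  obtain ⟨b, hb⟩ : ∃ b, b = x n - z := ⟨_, rfl⟩
  obtain ⟨c, hc⟩ : ∃ c, c = x (n - 1) - z := ⟨_, rfl⟩
  have e1 : x (n + 1) - x n = a - b := by rw [ha, hb]; abel
  have e2 : x n - x (n - 1) = b - c := by rw [hb, hc]; abel
  have e3 : x (n + 1) - (x n + α • (x n - x (n - 1))) = a - b - α • (b - c) := by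
    rw [← e1, ← e2]; abel
  have e4 : z - x (n + 1) = -a := by rw [ha]; abel
  rw [e3, e4] at h2
  rw [e1, e2, ← ha, ← hb, ← hc]
  have h5 : 0 ≤ α * ‖(a - b) - (b - c)‖ ^ 2 := by positivity
  simp only [← real_inner_self_eq_norm_sq, inner_sub_left, inner_sub_right, inner_neg_right,
    real_inner_smul_left] at h2 h5 ⊢
  rw [real_inner_comm a b, real_inner_comm a c, real_inner_comm b c] at *
  linarith
end

section
/- Let f and g be monotone bifunctions on K, let (xₙ) be a sequence generated by the inertial proximal algorithm (IPA), let u ∈ S, and let p ∈ N_{S_f}(u) satisfy g(u,y) + ⟨p, y − u⟩ ≥ 0 for all y ∈ K. Set aₙ := ‖xₙ − u‖². Then for each n ≥ 1 the following inequality holds in ℝ ∪ {+∞}: a_{n+1} − aₙ − α(aₙ − a_{n−1}) + λₙβₙ f(u, x_{n+1}) ≤ (α − 1)‖x_{n+1} − xₙ‖² + 2α‖xₙ − x_{n−1}‖² + λₙβₙ·( sup_{y∈K} (⟨(2/βₙ)p, y⟩ + f(y,u)) − (2/βₙ)⟨p, u⟩ ). -/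
set_option autoImplicit false

open RealInnerProductSpace Filter Topology

variable {H : Type*} [NormedAddCommGroup H] [InnerProductSpace ℝ H]

/-- The solution set of the lower-level equilibrium problem: `S_f = {u ∈ K : f(u,y) ≥ 0 ∀ y ∈ K}`. -/
def Sf (K : Set H) (f : H → H → ℝ) : Set H := {u ∈ K | ∀ y ∈ K, 0 ≤ f u y}

/-- The solution set of the bilevel equilibrium problem:
`S = {x̄ ∈ S_f : g(x̄,y) ≥ 0 ∀ y ∈ S_f}`. -/
def Sol (K : Set H) (f g : H → H → ℝ) : Set H :=
  {u ∈ Sf K f | ∀ y ∈ Sf K f, 0 ≤ g u y}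

/-- `p` belongs to the normal cone of `C` at `u`. -/
def InNormalCone (C : Set H) (u p : H) : Prop :=
  u ∈ C ∧ ∀ z ∈ C, ⟪p, z - u⟫ ≤ 0

/-- `x` is a sequence generated by the inertial proximal algorithm (IPA). -/
def IPA (K : Set H) (f g : H → H → ℝ) (α : ℝ) (lam beta : ℕ → ℝ) (x : ℕ → H) : Prop :=
  (∀ n, x n ∈ K) ∧
  ∀ n, 1 ≤ n → ∀ y ∈ K,
    0 ≤ beta n * f (x (n + 1)) y + g (x (n + 1)) y +
      (1 / lam n) * ⟪x (n + 1) - (x n + α • (x n - x (n - 1))), y - x (n + 1)⟫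

/-- The geometric condition (GC) for a pair `(u, p)` with `p ∈ N_{S_f}(u)`:
for every `n` the supremum `Fₙ = sup_{y ∈ K} (⟨(2/βₙ)p, y⟩ + f(y,u))` is finite and the series
`∑ₙ λₙβₙ (Fₙ − (2/βₙ)⟨p,u⟩)` converges. -/
def GC (K : Set H) (f : H → H → ℝ) (lam beta : ℕ → ℝ) (u p : H) : Prop :=
  ∃ F : ℕ → ℝ,
    (∀ n, IsLUB {r : ℝ | ∃ y ∈ K, r = ⟪(2 / beta n) • p, y⟫ + f y u} (F n)) ∧
    Summable (fun n => lam n * beta n * (F n - (2 / beta n) * ⟪p, u⟫))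

theorem stmt2 {H : Type*} [NormedAddCommGroup H] [InnerProductSpace ℝ H] [CompleteSpace H]
    (K : Set H) (hKne : K.Nonempty) (hKcl : IsClosed K) (hKcv : Convex ℝ K)
    (f g : H → H → ℝ)
    (hfmono : ∀ x ∈ K, ∀ y ∈ K, f x y + f y x ≤ 0)
    (hgmono : ∀ x ∈ K, ∀ y ∈ K, g x y + g y x ≤ 0)
    (α : ℝ) (hα0 : 0 ≤ α) (hα1 : α ≤ 1)
    (lam beta : ℕ → ℝ) (hlam : ∀ n, 0 < lam n) (hbeta : ∀ n, 0 < beta n)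
    (x : ℕ → H) (hx : IPA K f g α lam beta x)
    (u : H) (hu : u ∈ Sol K f g)
    (p : H) (hp : InNormalCone (Sf K f) u p)
    (hpg : ∀ y ∈ K, 0 ≤ g u y + ⟪p, y - u⟫) :
    ∀ n, 1 ≤ n →
      ((‖x (n + 1) - u‖ ^ 2 - ‖x n - u‖ ^ 2 - α * (‖x n - u‖ ^ 2 - ‖x (n - 1) - u‖ ^ 2)
          + lam n * beta n * f u (x (n + 1)) : ℝ) : EReal) ≤
        (((α - 1) * ‖x (n + 1) - x n‖ ^ 2 + 2 * α * ‖x n - x (n - 1)‖ ^ 2 : ℝ) : EReal)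
        + ((lam n * beta n : ℝ) : EReal) *
          ((⨆ y ∈ K, ((⟪(2 / beta n) • p, y⟫ + f y u : ℝ) : EReal))
            - (((2 / beta n) * ⟪p, u⟫ : ℝ) : EReal)) := by
  intro n hn
  obtain ⟨hxK, hstep⟩ := hx
  have huK : u ∈ K := hu.1.1
  have hvK : x (n + 1) ∈ K := hxK (n + 1)
  have h1 := hstep n hn u huK
  have hgm := hgmono _ hvK u huK
  have hfm := hfmono _ hvK u huK
  have hpv := hpg _ hvK
  have hl := hlam n
  have hb := hbeta n
  generalize x (n + 1) = v at *
  generalize x n = w at *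
  generalize x (n - 1) = z at *
  generalize lam n = l at *
  generalize beta n = b at *
  have key : ‖v - u‖ ^ 2 - ‖w - u‖ ^ 2 - α * (‖w - u‖ ^ 2 - ‖z - u‖ ^ 2) + l * b * f u v ≤
      ((α - 1) * ‖v - w‖ ^ 2 + 2 * α * ‖w - z‖ ^ 2) +
      l * b * ((⟪(2 / b) • p, v⟫ + f v u) - (2 / b) * ⟪p, u⟫) := by
    have e1 : l * b * ((⟪(2 / b) • p, v⟫ + f v u) - (2 / b) * ⟪p, u⟫)
        = l * b * f v u + 2 * l * ⟪p, v - u⟫ := by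
      rw [real_inner_smul_left, inner_sub_right]
      field_simp
      ring
    have h2 : 0 ≤ l * b * f v u + l * g v u + ⟪v - (w + α • (w - z)), u - v⟫ := by
      have := mul_nonneg hl.le h1
      have e : l * (b * f v u + g v u + 1 / l * ⟪v - (w + α • (w - z)), u - v⟫)
        = l * b * f v u + l * g v u + ⟪v - (w + α • (w - z)), u - v⟫ := by
        field_simp
      linarith
    have h3 : l * g v u ≤ l * ⟪p, v - u⟫ := mul_le_mul_of_nonneg_left (by linarith) hl.le
    have h4 : l * b * (f v u + f u v) ≤ 0 :=
      mul_nonpos_of_nonneg_of_nonpos (mul_pos hl hb).le hfm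
    have h5 : 0 ≤ α * ‖(v - w) - (w - z)‖ ^ 2 := by positivity
    have e2 : ‖v - u‖ ^ 2 - ‖w - u‖ ^ 2 - α * (‖w - u‖ ^ 2 - ‖z - u‖ ^ 2)
        = -2 * ⟪v - (w + α • (w - z)), u - v⟫ + (α - 1) * ‖v - w‖ ^ 2
          + 2 * α * ‖w - z‖ ^ 2 - α * ‖(v - w) - (w - z)‖ ^ 2 := by
      simp only [← real_inner_self_eq_norm_sq, inner_sub_left, inner_sub_right, inner_add_left,
        real_inner_smul_left]
      rw [real_inner_comm v u, real_inner_comm w u, real_inner_comm z u, real_inner_comm w v,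
        real_inner_comm z v, real_inner_comm z w]
      ring
    rw [e1]
    linarith
  refine (EReal.coe_le_coe_iff.mpr key).trans ?_
  rw [EReal.coe_add, EReal.coe_mul (l * b), EReal.coe_sub]
  refine add_le_add le_rfl (mul_le_mul_of_nonneg_left (EReal.sub_le_sub ?_ le_rfl) ?_)
  · exact le_iSup₂ (f := fun y (_ : y ∈ K) => ((⟪(2 / b) • p, y⟫ + f y u : ℝ) : EReal)) v hvK
  · exact_mod_cast (mul_pos hl hb).le
end

section
/- Let f and g be monotone bifunctions on K, let 0 ≤ α < 1/3, and let (xₙ) be a sequence generated by the inertial proximal algorithm (IPA). Assume there exist u ∈ S and p ∈ N_{S_f}(u) with g(u,y) + ⟨p, y − u⟩ ≥ 0 for all y ∈ K such that the geometric condition (GC) holds for the pair (u,p). Then ∑_{n=1}^∞ ‖xₙ − x_{n−1}‖² < +∞. -/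
set_option autoImplicit false

open RealInnerProductSpace Filter Topology

variable {H : Type*} [NormedAddCommGroup H] [InnerProductSpace ℝ H]

theorem aux_real (φ d ε : ℕ → ℝ) (α : ℝ) (hα0 : 0 ≤ α) (hα1 : α < 1 / 3)
    (hφ : ∀ n, 0 ≤ φ n) (hd : ∀ n, 0 ≤ d n) (hε : ∀ n, 0 ≤ ε n) (hs : Summable ε)
    (h : ∀ n, φ (n + 2) - φ (n + 1) - α * (φ (n + 1) - φ n) + (1 - α) * d (n + 1)
      - 2 * α * d n ≤ ε n) : Summable d := by
  have key : ∀ n, φ (n + 1) - α * φ n + 2 * α * d n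
      + (1 - 3 * α) * ∑ i ∈ Finset.range n, d (i + 1)
      ≤ φ 1 - α * φ 0 + 2 * α * d 0 + ∑ i ∈ Finset.range n, ε i := by
    intro n
    induction n with
    | zero => simp
    | succ k ih =>
      rw [Finset.sum_range_succ, Finset.sum_range_succ]
      have := h k
      have e : k + 1 + 1 = k + 2 := rfl
      rw [e]
      nlinarith
  set C := |φ 1 - α * φ 0 + 2 * α * d 0 + ∑' i, ε i| with hC
  have hC0 : 0 ≤ C := abs_nonneg _
  have key2 : ∀ n, φ (n + 1) - α * φ n + 2 * α * d n
      + (1 - 3 * α) * ∑ i ∈ Finset.range n, d (i + 1) ≤ C := by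
    intro n
    have h1 := hs.sum_le_tsum (Finset.range n) (fun i _ => hε i)
    have h2 := le_abs_self (φ 1 - α * φ 0 + 2 * α * d 0 + ∑' i, ε i)
    linarith [key n]
  have hS : ∀ n, 0 ≤ ∑ i ∈ Finset.range n, d (i + 1) :=
    fun n => Finset.sum_nonneg (fun i _ => hd _)
  have hb : ∀ n, φ n ≤ φ 0 + 2 * C := by
    intro n
    induction n with
    | zero => linarith
    | succ k ih =>
      have h1 := key2 k
      have h2 := mul_nonneg (by linarith : 0 ≤ 1 - 3 * α) (hS k)
      have h3 := mul_nonneg hα0 (hd k)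
      have h4 := mul_le_mul_of_nonneg_left ih hα0
      have h5 : α * (φ 0 + 2 * C) ≤ 1 / 3 * (φ 0 + 2 * C) :=
        mul_le_mul_of_nonneg_right hα1.le (by linarith [hφ 0])
      linarith [hφ 0]
  have : Summable (fun n => d (n + 1)) := by
    refine summable_of_sum_range_le (c := (C + α * (φ 0 + 2 * C)) / (1 - 3 * α))
      (fun n => hd _) (fun n => ?_)
    rw [le_div_iff₀ (by linarith)]
    have h3 := mul_nonneg hα0 (hd n)
    have h4 := mul_le_mul_of_nonneg_left (hb n) hα0
    linarith [key2 n, hφ (n + 1)]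
  exact (summable_nat_add_iff 1).1 this

theorem aux_inner {H : Type*} [NormedAddCommGroup H] [InnerProductSpace ℝ H]
    (a b c u : H) (α e : ℝ) (hα0 : 0 ≤ α)
    (h : 2 * ⟪c - (b + α • (b - a)), c - u⟫ ≤ e) :
    ‖c - u‖ ^ 2 - ‖b - u‖ ^ 2 - α * (‖b - u‖ ^ 2 - ‖a - u‖ ^ 2) + (1 - α) * ‖c - b‖ ^ 2
      - 2 * α * ‖b - a‖ ^ 2 ≤ e := by
  obtain ⟨v, hv⟩ : ∃ v, v = b - u := ⟨_, rfl⟩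
  obtain ⟨s, hs⟩ : ∃ s, s = c - b := ⟨_, rfl⟩
  obtain ⟨t, ht⟩ : ∃ t, t = b - a := ⟨_, rfl⟩
  have e1 : c - u = s + v := by rw [hs, hv]; abel
  have e2 : a - u = v - t := by rw [ht, hv]; abel
  have e3 : c - (b + α • (b - a)) = s - α • t := by rw [hs, ht]; abel
  rw [e3, e1] at h
  rw [e1, e2, ← hv, ← hs, ← ht, norm_add_sq_real, norm_sub_sq_real]
  rw [inner_sub_left, inner_add_right, inner_add_right, inner_smul_left, inner_smul_left,
    real_inner_self_eq_norm_sq, real_inner_comm s t, real_inner_comm v t] at h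
  simp only [conj_trivial] at h
  have h1 := norm_sub_sq_real s t
  have h2 := mul_nonneg hα0 (sq_nonneg ‖s - t‖)
  rw [h1] at h2
  have h3 := real_inner_comm s t
  have h4 := real_inner_comm v t
  rw [h3] at *
  rw [h4] at *
  nlinarith

theorem stmt3 {H : Type*} [NormedAddCommGroup H] [InnerProductSpace ℝ H] [CompleteSpace H]
    (K : Set H) (hKne : K.Nonempty) (hKcl : IsClosed K) (hKcv : Convex ℝ K)
    (f g : H → H → ℝ)
    (hfmono : ∀ x ∈ K, ∀ y ∈ K, f x y + f y x ≤ 0)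
    (hgmono : ∀ x ∈ K, ∀ y ∈ K, g x y + g y x ≤ 0)
    (α : ℝ) (hα0 : 0 ≤ α) (hα1 : α < 1 / 3)
    (lam beta : ℕ → ℝ) (hlam : ∀ n, 0 < lam n) (hbeta : ∀ n, 0 < beta n)
    (x : ℕ → H) (hx : IPA K f g α lam beta x)
    (hex : ∃ u ∈ Sol K f g, ∃ p : H, InNormalCone (Sf K f) u p ∧
      (∀ y ∈ K, 0 ≤ g u y + ⟪p, y - u⟫) ∧ GC K f lam beta u p) :
    Summable (fun n => ‖x (n + 1) - x n‖ ^ 2) := by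
  obtain ⟨u, ⟨⟨huK, huf⟩, hug⟩, p, hp, hgp, F, hF, hsum⟩ := hex
  obtain ⟨hxK, hx⟩ := hx
  have hfu : f u u = 0 := le_antisymm (by linarith [hfmono u huK u huK]) (huf u huK)
  have hFle : ∀ n, ∀ y ∈ K, (2 / beta n) * ⟪p, y⟫ + f y u ≤ F n := by
    intro n y hy
    have := (hF n).1 ⟨y, hy, rfl⟩
    simpa [inner_smul_left] using this
  refine aux_real (fun n => ‖x n - u‖ ^ 2) _
    (fun n => lam (n + 1) * beta (n + 1) * (F (n + 1) - (2 / beta (n + 1)) * ⟪p, u⟫)) α hα0 hα1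
    (fun n => sq_nonneg _) (fun n => sq_nonneg _) (fun n => ?_)
    ((summable_nat_add_iff 1).2 hsum) (fun n => ?_)
  · refine mul_nonneg (mul_pos (hlam _) (hbeta _)).le ?_
    linarith [hFle (n + 1) u huK]
  · refine aux_inner (x n) (x (n + 1)) (x (n + 2)) u α _ hα0 ?_
    have h1 := hx (n + 1) (by omega) u huK
    simp only [Nat.add_sub_cancel] at h1
    have e : n + 1 + 1 = n + 2 := rfl
    rw [e] at h1
    have hz := hxK (n + 2)
    set z := x (n + 2) with hzdef
    have hl := hlam (n + 1)
    have hb := hbeta (n + 1)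
    set l := lam (n + 1)
    set b := beta (n + 1)
    have h2 := hgmono z hz u huK
    have h3 := hgp z hz
    have h4 := hFle (n + 1) z hz
    have h5 := hfmono z hz u huK
    have h6 := huf z hz
    rw [inner_sub_right] at h3
    rw [← neg_sub z u, inner_neg_right] at h1
    set Q := ⟪z - (x (n + 1) + α • (x (n + 1) - x n)), z - u⟫
    have h7 : 0 ≤ b * (F (n + 1) - (2 / b * ⟪p, z⟫ + f z u)) :=
      mul_nonneg hb.le (by linarith)
    have h8 : b * (F (n + 1) - (2 / b * ⟪p, z⟫ + f z u))
        = b * F (n + 1) - 2 * ⟪p, z⟫ - b * f z u := by field_simp; ring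
    have h9 : b * f z u ≤ 0 := mul_nonpos_of_nonneg_of_nonpos hb.le (by linarith)
    have h10 : 1 / l * Q ≤ (b * F (n + 1) - 2 * ⟪p, u⟫) / 2 := by linarith
    have h11 := mul_le_mul_of_nonneg_left h10 hl.le
    have h12 : l * (1 / l * Q) = Q := by field_simp
    have h13 : l * b * (F (n + 1) - 2 / b * ⟪p, u⟫)
        = l * (b * F (n + 1) - 2 * ⟪p, u⟫) := by field_simp
    rw [h13]
    linarith
end

section
/- Let f and g be monotone bifunctions on K, let 0 ≤ α < 1/3, and let (xₙ) be a sequence generated by the inertial proximal algorithm (IPA). Let u ∈ S and p ∈ N_{S_f}(u) satisfy g(u,y) + ⟨p, y − u⟩ ≥ 0 for all y ∈ K, and assume the geometric condition (GC) holds for the pair (u,p). Then the series of nonnegative terms ∑_{n=1}^∞ λₙβₙ f(u, x_{n+1}) converges. -/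
set_option autoImplicit false

open RealInnerProductSpace Filter Topology

variable {H : Type*} [NormedAddCommGroup H] [InnerProductSpace ℝ H]

theorem aux_scalar (α : ℝ) (hα0 : 0 ≤ α) (hα1 : α < 1 / 3) (φ D a e : ℕ → ℝ)
    (hφ : ∀ n, 0 ≤ φ n) (hD : ∀ n, 0 ≤ D n) (ha : ∀ n, 0 ≤ a n) (he : ∀ n, 0 ≤ e n)
    (hes : Summable e)
    (h : ∀ n, φ (n + 2) - φ (n + 1) - α * (φ (n + 1) - φ n) + (1 - α) * D (n + 1)
      - 2 * α * D n + a n ≤ e n) : Summable a := by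
  obtain ⟨M, hM⟩ : ∃ M, M = |φ 1 - α * φ 0 + (1 - α) * D 0| + ∑' i, e i := ⟨_, rfl⟩
  have hM0 : 0 ≤ M := by
    rw [hM]; exact add_nonneg (abs_nonneg _) (tsum_nonneg he)
  have key : ∀ N, φ (N + 1) - α * φ N + (1 - α) * D N + ∑ i ∈ Finset.range N, a i ≤
      φ 1 - α * φ 0 + (1 - α) * D 0 + ∑ i ∈ Finset.range N, e i := by
    intro N
    induction N with
    | zero => simp
    | succ k ih =>
      rw [Finset.sum_range_succ, Finset.sum_range_succ]
      have h1 := h k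
      have h2 : 0 ≤ (1 - 3 * α) * D k := mul_nonneg (by linarith) (hD k)
      have e1 : k + 1 + 1 = k + 2 := rfl
      rw [e1]
      linarith
  have key2 : ∀ N, φ (N + 1) - α * φ N + ∑ i ∈ Finset.range N, a i ≤ M := by
    intro N
    have h1 := key N
    have h2 := hes.sum_le_tsum (Finset.range N) (fun i _ => he i)
    have h3 := le_abs_self (φ 1 - α * φ 0 + (1 - α) * D 0)
    have h4 : 0 ≤ (1 - α) * D N := mul_nonneg (by linarith) (hD N)
    linarith
  have hB : ∀ N, φ N ≤ φ 0 + 2 * M := by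
    intro N
    induction N with
    | zero => linarith
    | succ k ih =>
      have h1 := key2 k
      have h2 : 0 ≤ ∑ i ∈ Finset.range k, a i := Finset.sum_nonneg (fun i _ => ha i)
      have h3 := mul_le_mul_of_nonneg_left ih hα0
      have h4 : 0 ≤ (1 / 3 - α) * (φ 0 + 2 * M) :=
        mul_nonneg (by linarith) (by linarith [hφ 0])
      linarith [hφ 0]
  refine summable_of_sum_range_le (c := M + α * (φ 0 + 2 * M)) ha (fun N => ?_)
  have h1 := key2 N
  have h3 := mul_le_mul_of_nonneg_left (hB N) hα0
  linarith [hφ (N + 1)]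

theorem aux_norm {H : Type*} [NormedAddCommGroup H] [InnerProductSpace ℝ H]
    (α : ℝ) (hα0 : 0 ≤ α) (hα1 : α ≤ 1) (u w x v : H) :
    ‖v - u‖ ^ 2 - ‖x - u‖ ^ 2 - α * (‖x - u‖ ^ 2 - ‖w - u‖ ^ 2) + (1 - α) * ‖v - x‖ ^ 2
      - 2 * α * ‖x - w‖ ^ 2 ≤ - (2 * ⟪v - (x + α • (x - w)), u - v⟫) := by
  obtain ⟨a, rfl⟩ : ∃ a, v = u + a := ⟨v - u, by abel⟩
  obtain ⟨b, rfl⟩ : ∃ b, x = u + b := ⟨x - u, by abel⟩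
  obtain ⟨c, rfl⟩ : ∃ c, w = u + c := ⟨w - u, by abel⟩
  have h0 : 0 ≤ α * (1 - α) * ‖(a - b) - (b - c)‖ ^ 2 := by
    have : 0 ≤ 1 - α := by linarith
    positivity
  have h1 : 0 ≤ α * ‖(a - b) - (b - c)‖ ^ 2 := by positivity
  have e1 : u + a - (u + b + α • (u + b - (u + c))) = a - b - α • (b - c) := by
    simp only [add_sub_add_left_eq_sub]; abel
  have e2 : u - (u + a) = -a := by abel
  rw [e1, e2]
  simp only [add_sub_add_left_eq_sub, add_sub_cancel_left, ← real_inner_self_eq_norm_sq,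
    inner_sub_left, inner_sub_right, inner_neg_right, inner_smul_left, inner_smul_right,
    RCLike.conj_to_real] at h0 h1 ⊢
  rw [real_inner_comm a b, real_inner_comm a c, real_inner_comm b c] at *
  nlinarith

theorem stmt4 {H : Type*} [NormedAddCommGroup H] [InnerProductSpace ℝ H] [CompleteSpace H]
    (K : Set H) (hKne : K.Nonempty) (hKcl : IsClosed K) (hKcv : Convex ℝ K)
    (f g : H → H → ℝ)
    (hfmono : ∀ x ∈ K, ∀ y ∈ K, f x y + f y x ≤ 0)
    (hgmono : ∀ x ∈ K, ∀ y ∈ K, g x y + g y x ≤ 0)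
    (α : ℝ) (hα0 : 0 ≤ α) (hα1 : α < 1 / 3)
    (lam beta : ℕ → ℝ) (hlam : ∀ n, 0 < lam n) (hbeta : ∀ n, 0 < beta n)
    (x : ℕ → H) (hx : IPA K f g α lam beta x)
    (u : H) (hu : u ∈ Sol K f g)
    (p : H) (hp : InNormalCone (Sf K f) u p)
    (hpg : ∀ y ∈ K, 0 ≤ g u y + ⟪p, y - u⟫)
    (hGC : GC K f lam beta u p) :
    Summable (fun n => lam n * beta n * f u (x (n + 1))) := by
  obtain ⟨hxK, hx⟩ := hx
  obtain ⟨⟨huK, huf⟩, -⟩ := hu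
  obtain ⟨F, hF, hS⟩ := hGC
  have hfuu : f u u = 0 := le_antisymm (by linarith [hfmono u huK u huK]) (huf u huK)
  rw [← summable_nat_add_iff 1] at hS ⊢
  refine aux_scalar α hα0 hα1 (fun n => ‖x n - u‖ ^ 2) (fun n => ‖x (n + 1) - x n‖ ^ 2) _ _
    (fun n => by positivity) (fun n => by positivity) (fun n => ?_) (fun n => ?_) hS (fun n => ?_)
  · exact mul_nonneg (mul_pos (hlam _) (hbeta _)).le (huf _ (hxK _))
  · have := (hF (n + 1)).1 ⟨u, huK, rfl⟩
    rw [real_inner_smul_left, hfuu] at this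
    exact mul_nonneg (mul_pos (hlam _) (hbeta _)).le (by linarith)
  · have hv := hxK (n + 1 + 1)
    have h1 := hx (n + 1) (by omega) u huK
    have h2 := (hF (n + 1)).1 ⟨x (n + 1 + 1), hv, rfl⟩
    have h3 := hpg _ hv
    have h4 := hgmono _ hv u huK
    have h5 := hfmono _ hv u huK
    have h6 := aux_norm α hα0 (by linarith) u (x n) (x (n + 1)) (x (n + 1 + 1))
    have hl := hlam (n + 1)
    have hb := hbeta (n + 1)
    simp only [Nat.add_sub_cancel] at h1
    rw [real_inner_smul_left] at h2
    rw [inner_sub_right] at h3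
    have e2 : n + 2 = n + 1 + 1 := rfl
    simp only [e2]
    generalize ⟪x (n + 1 + 1) - (x (n + 1) + α • (x (n + 1) - x n)), u - x (n + 1 + 1)⟫ = I at *
    generalize x (n + 1 + 1) = v at *
    generalize lam (n + 1) = l at *
    generalize beta (n + 1) = b at *
    have h7 : 0 ≤ b * f v u + (⟪p, v⟫ - ⟪p, u⟫) + 1 / l * I := by linarith
    have h8 : 0 ≤ l * b * f v u + l * (⟪p, v⟫ - ⟪p, u⟫) + I := by
      have := mul_nonneg hl.le h7
      have e : l * (b * f v u + (⟪p, v⟫ - ⟪p, u⟫) + 1 / l * I)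
        = l * b * f v u + l * (⟪p, v⟫ - ⟪p, u⟫) + I := by field_simp
      linarith
    have h9 := mul_le_mul_of_nonneg_left h2 (mul_pos hl hb).le
    have h10 := mul_le_mul_of_nonneg_left h5 (mul_pos hl hb).le
    have e3 : l * b * (2 / b * ⟪p, v⟫ + f v u) = 2 * l * ⟪p, v⟫ + l * b * f v u := by field_simp
    have e4 : l * b * (F (n + 1) - 2 / b * ⟪p, u⟫) = l * b * F (n + 1) - 2 * l * ⟪p, u⟫ := by
      field_simp
    rw [e3] at h9
    rw [e4]
    linarith
end

section
/- Let f and g be monotone bifunctions on K, let 0 ≤ α < 1/3, and let (xₙ) be a sequence generated by the inertial proximal algorithm (IPA). Assume there exist u ∈ S and p ∈ N_{S_f}(u) with g(u,y) + ⟨p, y − u⟩ ≥ 0 for all y ∈ K such that the geometric condition (GC) holds for the pair (u,p). Then the sequence (xₙ) is bounded. -/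
set_option autoImplicit false

open RealInnerProductSpace Filter Topology

variable {H : Type*} [NormedAddCommGroup H] [InnerProductSpace ℝ H]

theorem stmt5 {H : Type*} [NormedAddCommGroup H] [InnerProductSpace ℝ H] [CompleteSpace H]
    (K : Set H) (hKne : K.Nonempty) (hKcl : IsClosed K) (hKcv : Convex ℝ K)
    (f g : H → H → ℝ)
    (hfmono : ∀ x ∈ K, ∀ y ∈ K, f x y + f y x ≤ 0)
    (hgmono : ∀ x ∈ K, ∀ y ∈ K, g x y + g y x ≤ 0)
    (α : ℝ) (hα0 : 0 ≤ α) (hα1 : α < 1 / 3)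
    (lam beta : ℕ → ℝ) (hlam : ∀ n, 0 < lam n) (hbeta : ∀ n, 0 < beta n)
    (x : ℕ → H) (hx : IPA K f g α lam beta x)
    (hex : ∃ u ∈ Sol K f g, ∃ p : H, InNormalCone (Sf K f) u p ∧
      (∀ y ∈ K, 0 ≤ g u y + ⟪p, y - u⟫) ∧ GC K f lam beta u p) :
    ∃ M : ℝ, ∀ n, ‖x n‖ ≤ M := by
  obtain ⟨u, ⟨⟨huK, hfu⟩, _⟩, p, _, hgp, F, hF, hsum⟩ := hex
  obtain ⟨hxK, hstep⟩ := hx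
  set e : ℕ → ℝ := fun n => lam n * beta n * (F n - (2 / beta n) * ⟪p, u⟫) with he
  have hbd : ∀ n, ∀ w ∈ K, ⟪(2 / beta n) • p, w⟫ + f w u ≤ F n := fun n w hw =>
    (hF n).1 ⟨w, hw, rfl⟩
  have he0 : ∀ n, 0 ≤ e n := by
    intro n
    have h1 := hbd n u huK
    rw [real_inner_smul_left] at h1
    have h2 := hfu u huK
    have := hlam n
    have := hbeta n
    have h3 : 0 ≤ F n - (2 / beta n) * ⟪p, u⟫ := by linarith
    simp only [he]
    positivity
  have key : ∀ n, 2 * ⟪x (n + 2) - (x (n + 1) + α • (x (n + 1) - x n)), x (n + 2) - u⟫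
      ≤ e (n + 1) := by
    intro n
    have h1 := hstep (n + 1) (by omega) u huK
    simp only [Nat.add_sub_cancel] at h1
    have hw := hxK (n + 1 + 1)
    have h2 := hgmono _ hw u huK
    have h3 := hgp _ hw
    have h4 := hfmono _ hw u huK
    have h5 := hfu _ hw
    have h6 := hbd (n + 1) _ hw
    have hl := hlam (n + 1)
    have hb := hbeta (n + 1)
    rw [real_inner_smul_left] at h6
    have h7 : beta (n + 1) * (2 / beta (n + 1) * ⟪p, x (n + 1 + 1)⟫ + f (x (n + 1 + 1)) u)
        ≤ beta (n + 1) * F (n + 1) := mul_le_mul_of_nonneg_left h6 hb.le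
    have h8 : beta (n + 1) * (2 / beta (n + 1) * ⟪p, x (n + 1 + 1)⟫ + f (x (n + 1 + 1)) u)
        = 2 * ⟪p, x (n + 1 + 1)⟫ + beta (n + 1) * f (x (n + 1 + 1)) u := by
      field_simp
    have h9 : e (n + 1) = lam (n + 1) * (beta (n + 1) * F (n + 1) - 2 * ⟪p, u⟫) := by
      simp only [he]
      field_simp
    have h10 : beta (n + 1) * f (x (n + 1 + 1)) u ≤ 0 :=
      mul_nonpos_of_nonneg_of_nonpos hb.le (by linarith)
    rw [inner_sub_right] at h3
    have h11 : ⟪x (n + 1 + 1) - (x (n + 1) + α • (x (n + 1) - x n)), u - x (n + 1 + 1)⟫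
        = -⟪x (n + 2) - (x (n + 1) + α • (x (n + 1) - x n)), x (n + 2) - u⟫ := by
      rw [← inner_neg_right, neg_sub]
    rw [h11] at h1
    set I := ⟪x (n + 2) - (x (n + 1) + α • (x (n + 1) - x n)), x (n + 2) - u⟫
    have h12 : 2 * (1 / lam (n + 1) * I) ≤ beta (n + 1) * F (n + 1) - 2 * ⟪p, u⟫ := by
      linarith
    rw [h9]
    have h13 := mul_le_mul_of_nonneg_left h12 hl.le
    have h14 : lam (n + 1) * (2 * (1 / lam (n + 1) * I)) = 2 * I := by field_simp
    linarith
  set m : ℕ → ℝ := fun n => ‖x (n + 1) - u‖ ^ 2 - α * ‖x n - u‖ ^ 2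
    + (1 - α) * ‖x (n + 1) - x n‖ ^ 2 with hm
  have hms : ∀ n, m (n + 1) ≤ m n + e (n + 1) := by
    intro n
    have hk := key n
    simp only [hm]
    have hid : ∀ a b c : H, 2 * ⟪a - (b + α • (b - c)), a⟫ =
        ‖a‖ ^ 2 - (1 + α) * ‖b‖ ^ 2 + α * ‖c‖ ^ 2 + (1 - α) * ‖a - b‖ ^ 2
        - 2 * α * ‖b - c‖ ^ 2 + α * ‖(a - b) - (b - c)‖ ^ 2 := by
      intro a b c
      simp only [← real_inner_self_eq_norm_sq, inner_sub_left, inner_sub_right, inner_add_left,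
        inner_add_right, real_inner_smul_left]
      rw [real_inner_comm a b, real_inner_comm a c, real_inner_comm b c]
      ring
    have h := hid (x (n + 2) - u) (x (n + 1) - u) (x n - u)
    have e1 : x (n + 2) - u - (x (n + 1) - u + α • (x (n + 1) - u - (x n - u)))
      = x (n + 2) - (x (n + 1) + α • (x (n + 1) - x n)) := by
      rw [sub_sub_sub_cancel_right]; abel
    rw [e1, sub_sub_sub_cancel_right, sub_sub_sub_cancel_right] at h
    have h0 : 0 ≤ α * ‖x (n + 2) - x (n + 1) - (x (n + 1) - x n)‖ ^ 2 := by positivity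
    have h00 : 0 ≤ (1 - 3 * α) * ‖x (n + 1) - x n‖ ^ 2 :=
      mul_nonneg (by linarith) (by positivity)
    have e2 : x (n + 1 + 1) = x (n + 2) := rfl
    rw [e2]
    linarith
  have hmb : ∀ n, m n ≤ m 0 + ∑ i ∈ Finset.range (n + 1), e i := by
    intro n
    induction n with
    | zero => simpa using he0 0
    | succ k ih =>
      rw [Finset.sum_range_succ]
      linarith [hms k]
  set C := m 0 + ∑' i, e i with hC
  have hmC : ∀ n, m n ≤ C := fun n =>
    (hmb n).trans (by
      have := hsum.sum_le_tsum (Finset.range (n + 1)) (fun i _ => he0 i)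
      linarith)
  have h1α : 0 < 1 - α := by linarith
  set B := ‖x 0 - u‖ ^ 2 + |C| / (1 - α) with hB
  have hCB : C ≤ (1 - α) * B := by
    have h1 : (1 - α) * B = (1 - α) * ‖x 0 - u‖ ^ 2 + |C| := by
      rw [hB]; field_simp
    have h2 : 0 ≤ (1 - α) * ‖x 0 - u‖ ^ 2 := by positivity
    linarith [le_abs_self C]
  have hφ : ∀ n, ‖x n - u‖ ^ 2 ≤ B := by
    intro n
    induction n with
    | zero =>
      have : 0 ≤ |C| / (1 - α) := by positivity
      linarith
    | succ k ih =>
      have h1 := hmC k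
      simp only [hm] at h1
      have h2 : 0 ≤ (1 - α) * ‖x (k + 1) - x k‖ ^ 2 := by positivity
      have h3 := mul_le_mul_of_nonneg_left ih hα0
      linarith
  refine ⟨B + 1 + ‖u‖, fun n => ?_⟩
  have h1 : ‖x n‖ ≤ ‖x n - u‖ + ‖u‖ := norm_le_norm_sub_add _ _
  nlinarith [hφ n, sq_nonneg (‖x n - u‖ - 1), norm_nonneg (x n - u)]
end

section
/- Let f and g be monotone bifunctions on K with g ρ-strongly monotone for some ρ > 0, S_f nonempty, and such that for each y ∈ K there exists x* ∈ H with g(y,z) ≥ ⟨x*, z − y⟩ for all z ∈ K. Let (xₙ) be a sequence generated by the inertial proximal algorithm (IPA) with 0 ≤ α < 1/3 and with the sequence (λₙ) bounded. Then the sequence (xₙ) is bounded. -/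
set_option autoImplicit false

open RealInnerProductSpace Filter Topology

variable {H : Type*} [NormedAddCommGroup H] [InnerProductSpace ℝ H]

theorem stmt10 {H : Type*} [NormedAddCommGroup H] [InnerProductSpace ℝ H] [CompleteSpace H]
    (K : Set H) (hKne : K.Nonempty) (hKcl : IsClosed K) (hKcv : Convex ℝ K)
    (f g : H → H → ℝ)
    (hfmono : ∀ x ∈ K, ∀ y ∈ K, f x y + f y x ≤ 0)
    (hgmono : ∀ x ∈ K, ∀ y ∈ K, g x y + g y x ≤ 0)
    (ρ : ℝ) (hρ : 0 < ρ)
    (hgstrong : ∀ x ∈ K, ∀ y ∈ K, g x y + g y x ≤ -ρ * ‖x - y‖ ^ 2)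
    (hSfne : (Sf K f).Nonempty)
    (hgsub : ∀ y ∈ K, ∃ xs : H, ∀ z ∈ K, ⟪xs, z - y⟫ ≤ g y z)
    (α : ℝ) (hα0 : 0 ≤ α) (hα1 : α < 1 / 3)
    (lam beta : ℕ → ℝ) (hlam : ∀ n, 0 < lam n) (hbeta : ∀ n, 0 < beta n)
    (hlambdd : ∃ Λ : ℝ, ∀ n, lam n ≤ Λ)
    (x : ℕ → H) (hx : IPA K f g α lam beta x) :
    ∃ M : ℝ, ∀ n, ‖x n‖ ≤ M := by
  obtain ⟨u, huK, hu⟩ := hSfne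
  obtain ⟨us, hus⟩ := hgsub u huK
  obtain ⟨Λ, hΛ⟩ := hlambdd
  obtain ⟨hxK, hip⟩ := hx
  have key : ∀ n, ‖x (n+2) - u‖^2 - α * ‖x (n+1) - u‖^2 + (1-α) * ‖x (n+2) - x (n+1)‖^2
      ≤ ‖x (n+1) - u‖^2 - α * ‖x n - u‖^2 + 2*α * ‖x (n+1) - x n‖^2
        + 2 * lam (n+1) * (‖us‖ * ‖x (n+2) - u‖ - ρ * ‖x (n+2) - u‖^2) := by
    intro n
    have h1 := hip (n+1) (by omega) u huK
    have e1 : n + 1 + 1 = n + 2 := rfl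
    have e2 : n + 1 - 1 = n := rfl
    rw [e1, e2] at h1
    have hf : f (x (n+2)) u ≤ 0 := by
      have := hfmono _ (hxK (n+2)) u huK
      have := hu _ (hxK (n+2))
      linarith
    have hbf : beta (n+1) * f (x (n+2)) u ≤ 0 :=
      mul_nonpos_of_nonneg_of_nonpos (hbeta _).le hf
    have hg : g (x (n+2)) u ≤ ‖us‖ * ‖x (n+2) - u‖ - ρ * ‖x (n+2) - u‖^2 := by
      have h2 := hgstrong _ (hxK (n+2)) u huK
      have h3 := hus _ (hxK (n+2))
      have h4 := abs_le.1 (abs_real_inner_le_norm us (x (n+2) - u))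
      linarith [h4.1]
    have hl := hlam (n+1)
    set I := ⟪x (n+2) - (x (n+1) + α • (x (n+1) - x n)), u - x (n+2)⟫ with hI
    have h5 : 0 ≤ lam (n+1) * (‖us‖ * ‖x (n+2) - u‖ - ρ * ‖x (n+2) - u‖^2) + I := by
      have h6 : 0 ≤ lam (n+1) * ((‖us‖ * ‖x (n+2) - u‖ - ρ * ‖x (n+2) - u‖^2) + (1 / lam (n+1)) * I) :=
        mul_nonneg hl.le (by linarith)
      have h7 : lam (n+1) * ((1 / lam (n+1)) * I) = I := by field_simp
      rw [mul_add, h7] at h6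
      exact h6
    -- geometry
    obtain ⟨p, hp⟩ : ∃ p, p = x (n+2) - x (n+1) := ⟨_, rfl⟩
    obtain ⟨q, hq⟩ : ∃ q, q = x (n+1) - x n := ⟨_, rfl⟩
    obtain ⟨w, hw⟩ : ∃ w, w = x (n+1) - u := ⟨_, rfl⟩
    have ha2 : x (n+2) - u = w + p := by rw [hp, hw]; abel
    have ha0 : x n - u = w - q := by rw [hq, hw]; abel
    have hI2 : I = - ⟪p - α • q, w + p⟫ := by
      rw [hI, ← inner_neg_right, ← ha2, hp, hq]
      congr 1 <;> abel
    have hsq : 0 ≤ ‖p - q‖^2 := sq_nonneg _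
    rw [hI2] at h5
    rw [ha2] at h5 ⊢
    rw [ha0, ← hp, ← hq, ← hw]
    rw [norm_sub_sq_real] at hsq
    have e3 := norm_add_sq_real w p
    have e4 := norm_sub_sq_real w q
    have e5 : ⟪p - α • q, w + p⟫ = ⟪w, p⟫ + ‖p‖^2 - α * ⟪w, q⟫ - α * ⟪p, q⟫ := by
      rw [inner_sub_left, inner_add_right, inner_smul_left, inner_add_right,
        real_inner_self_eq_norm_sq, real_inner_comm w p, real_inner_comm w q, real_inner_comm p q]
      simp; ring
    rw [e5] at h5
    have hsq' := mul_nonneg hα0 hsq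
    rw [e4]
    nlinarith [h5, hsq', e3]
  have hΛ0 : 0 < Λ := lt_of_lt_of_le (hlam 0) (hΛ 0)
  set C := ‖us‖ with hC
  have hC0 : 0 ≤ C := norm_nonneg _
  clear_value C
  obtain ⟨P, hP⟩ : ∃ P, P = 2 * Λ * (C^2/ρ) := ⟨_, rfl⟩
  have hP0 : 0 ≤ P := by rw [hP]; positivity
  obtain ⟨E, hE⟩ : ∃ E : ℕ → ℝ, ∀ n, E n = ‖x (n+1) - u‖^2 - α * ‖x n - u‖^2
      + 2*α * ‖x (n+1) - x n‖^2 := ⟨_, fun n => rfl⟩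
  have hk : 0 < 1 - 3*α := by linarith
  obtain ⟨B, hB⟩ : ∃ B, B = (C/ρ)^2 + 2*α*(P/(1-3*α)) := ⟨_, rfl⟩
  have step : ∀ n, E (n+1) ≤ max (E n) B := by
    intro n
    have h := key n
    by_contra hcon
    push Not at hcon
    obtain ⟨h1, h2⟩ := max_lt_iff.1 hcon
    rw [hE, hE] at h1
    rw [hE] at h2
    have e1 : n + 1 + 1 = n + 2 := rfl
    rw [e1] at h1 h2
    have hd0 := norm_nonneg (x (n+2) - u)
    have hl := hlam (n+1)
    have hL := hΛ (n+1)
    generalize ‖x (n+2) - u‖ = d at *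
    have hδ := sq_nonneg ‖x (n+2) - x (n+1)‖
    generalize ‖x (n+2) - x (n+1)‖^2 = δ at *
    have h3 : (1-3*α)*δ < 2 * lam (n+1) * (C * d - ρ * d^2) := by linarith
    have h4 : 0 < 2 * lam (n+1) * (C * d - ρ * d^2) := lt_of_le_of_lt (by positivity) h3
    have h5 : 0 < C * d - ρ * d^2 := pos_of_mul_pos_right h4 (by positivity)
    have h6 : d ≤ C/ρ := by
      rw [le_div_iff₀ hρ]
      by_contra hc
      push Not at hc
      nlinarith
    have h7 : C * d - ρ * d^2 ≤ C^2/ρ := by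
      have : C * d ≤ C * (C/ρ) := mul_le_mul_of_nonneg_left h6 hC0
      have e : C * (C/ρ) = C^2/ρ := by ring
      nlinarith [mul_nonneg hρ.le (sq_nonneg d)]
    have h8 : 2 * lam (n+1) * (C * d - ρ * d^2) ≤ P := by
      rw [hP]
      exact mul_le_mul (by linarith) h7 h5.le (by positivity)
    have h9 : δ ≤ P/(1-3*α) := by
      rw [le_div_iff₀ hk]; linarith
    have h10 : d^2 ≤ (C/ρ)^2 := pow_le_pow_left₀ hd0 h6 2
    have h11 : 2*α*δ ≤ 2*α*(P/(1-3*α)) := mul_le_mul_of_nonneg_left h9 (by positivity)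
    have h12 : 0 ≤ α * ‖x (n+1) - u‖^2 := by positivity
    linarith
  have hEb : ∀ n, E n ≤ max (E 0) B := by
    intro n
    induction n with
    | zero => exact le_max_left _ _
    | succ k ih => exact (step k).trans (max_le ih (le_max_right _ _))
  obtain ⟨M, hM⟩ : ∃ M, M = max (max (E 0) B) 0 := ⟨_, rfl⟩
  have hM0 : 0 ≤ M := by rw [hM]; exact le_max_right _ _
  have hEM : ∀ n, E n ≤ M := fun n => by rw [hM]; exact (hEb n).trans (le_max_left _ _)
  have ha : ∀ n, ‖x n - u‖^2 ≤ ‖x 0 - u‖^2 + 2 * M := by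
    intro n
    induction n with
    | zero => linarith
    | succ k ih =>
      have h1 := hEM k
      rw [hE] at h1
      have h2 : 0 ≤ 2*α * ‖x (k+1) - x k‖^2 := by positivity
      have h3 := mul_le_mul_of_nonneg_left ih hα0
      have h4 : α * (‖x 0 - u‖^2 + 2 * M) ≤ 1/3 * (‖x 0 - u‖^2 + 2 * M) :=
        mul_le_mul_of_nonneg_right hα1.le (by positivity)
      have h5 := sq_nonneg ‖x 0 - u‖
      linarith
  refine ⟨‖x 0 - u‖^2 + 2 * M + 1 + ‖u‖, fun n => ?_⟩
  have h1 := ha n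
  have h2 : ‖x n‖ ≤ ‖x n - u‖ + ‖u‖ := by simpa using norm_add_le (x n - u) u
  nlinarith [sq_nonneg (‖x n - u‖ - 1), norm_nonneg (x n - u)]
end

section
/- (Weak convergence for equilibrium problems under a saddle point constraint.) Let H₁, H₂ be real Hilbert spaces, U ⊆ H₁, V ⊆ H₂ nonempty closed convex sets, K := U × V, and L : U × V → ℝ closed convex-concave (for each (u,v) ∈ U × V, L(·,v) and −L(u,·) are convex and lower semicontinuous). Let A : U → H₁ and B : V → H₂ be monotone maps (⟨A u − A u', u − u'⟩ ≥ 0 for u,u' ∈ U, and similarly for B). Define f((u₁,v₁),(u₂,v₂)) := L(u₂,v₁) − L(u₁,v₂) and g((u₁,v₁),(u₂,v₂)) := ⟨A u₁, u₂ − u₁⟩ + ⟨B v₁, v₂ − v₁⟩ on K × K, and assume f and g are upper hemicontinuous. Let S_L := S_f be the set of saddle points of L and S_VL := {(x̄,ȳ) ∈ S_L : ⟨A x̄, u − x̄⟩ + ⟨B ȳ, v − ȳ⟩ ≥ 0 for all (u,v) ∈ S_L}. Assume S_VL is nonempty and that for every (ū,v̄) ∈ S_VL there exists (p,q) ∈ N_{S_L}(ū,v̄)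 with g((ū,v̄),(u,v)) + ⟨(p,q), (u,v) − (ū,v̄)⟩ ≥ 0 for all (u,v) ∈ K, for which the geometric condition (GC) holds for the pair ((ū,v̄),(p,q)) with respect to f. Let ((xₙ¹,xₙ²)) be a sequence in K generated by the inertial proximal algorithm (IPA) for this f and g, with 0 ≤ α < 1/3, liminf_{n→∞} λₙ > 0 and βₙ → +∞. Then ((xₙ¹,xₙ²)) converges weakly to an element of S_VL. -/
set_option autoImplicit false

open RealInnerProductSpace

/-- The product inner product on `H₁ × H₂`. -/
noncomputable def ip {H₁ H₂ : Type*} [NormedAddCommGroup H₁] [InnerProductSpace ℝ H₁]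
    [NormedAddCommGroup H₂] [InnerProductSpace ℝ H₂] (a b : H₁ × H₂) : ℝ :=
  ⟪a.1, b.1⟫ + ⟪a.2, b.2⟫

section Aux
open RealInnerProductSpace Filter Topology

lemma aux_wlim_mem {H : Type*} [NormedAddCommGroup H] [InnerProductSpace ℝ H] [CompleteSpace H]
    {l : Filter ℕ} [NeBot l] {C : Set H} (hC : IsClosed C) (hCc : Convex ℝ C) (x : ℕ → H) (w : H)
    (hx : ∀ᶠ n in l, x n ∈ C) (hw : ∀ z, Tendsto (fun n => ⟪x n, z⟫) l (𝓝 ⟪w, z⟫)) : w ∈ C := by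
  by_contra hwC
  obtain ⟨F, u, h1, h2⟩ := geometric_hahn_banach_closed_point hCc hC hwC
  set z := (InnerProductSpace.toDual ℝ H).symm F with hz
  have hF : ∀ y, F y = ⟪y, z⟫ := by
    intro y
    rw [real_inner_comm, hz, InnerProductSpace.toDual_symm_apply]
  have := le_of_tendsto (hw z) (hx.mono fun n hn => by
    have := h1 _ hn
    rw [hF] at this
    exact this.le)
  rw [hF] at h2
  linarith

lemma aux_ultra {H : Type*} [NormedAddCommGroup H] [InnerProductSpace ℝ H] [CompleteSpace H]
    (l : Ultrafilter ℕ) (x : ℕ → H) (R : ℝ) (hR : ∀ n, ‖x n‖ ≤ R) :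
    ∃ w : H, ∀ z, Tendsto (fun n => ⟪x n, z⟫) l (𝓝 ⟪w, z⟫) := by
  have hc := WeakDual.isCompact_closedBall (0 : StrongDual ℝ H) R
  let X : ℕ → WeakDual ℝ H := fun n => StrongDual.toWeakDual (InnerProductSpace.toDual ℝ H (x n))
  have hX : ∀ n, X n ∈ WeakDual.toStrongDual ⁻¹' Metric.closedBall (0 : StrongDual ℝ H) R := by
    intro n
    simp [X, hR n]
  obtain ⟨F, -, hF⟩ := hc.ultrafilter_le_nhds (l.map X) (by
    rw [le_principal_iff]
    exact Filter.mem_map.2 (Filter.univ_mem' hX))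
  refine ⟨(InnerProductSpace.toDual ℝ H).symm (WeakDual.toStrongDual F), fun z => ?_⟩
  have h1 : Tendsto X l (𝓝 F) := hF
  have h2 := ((WeakDual.eval_continuous z).tendsto F).comp h1
  rw [InnerProductSpace.toDual_symm_apply]
  exact h2

lemma aux_contr (α : ℝ) (h0 : 0 ≤ α) (h1 : α < 1) (φ : ℕ → ℝ) (l : ℝ)
    (h : Tendsto (fun n => φ (n + 1) - α * φ n) atTop (𝓝 l)) :
    Tendsto φ atTop (𝓝 (l / (1 - α))) := by
  have ha : 0 < 1 - α := by linarith
  rw [Metric.tendsto_atTop] at h ⊢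
  intro ε hε
  obtain ⟨N, hN⟩ := h (ε / 2 * (1 - α)) (by positivity)
  have key : ∀ k, |φ (N + k) - l / (1 - α)| ≤ α ^ k * |φ N - l / (1 - α)| + ε / 2 := by
    intro k
    induction k with
    | zero => simp; positivity
    | succ k ih =>
      have h2 := hN (N + k) (by omega)
      rw [Real.dist_eq] at h2
      have e : φ (N + (k + 1)) - l / (1 - α)
          = (φ (N + k + 1) - α * φ (N + k) - l) + α * (φ (N + k) - l / (1 - α)) := by
        rw [← add_assoc]; field_simp; ring
      rw [e]
      calc _ ≤ |φ (N + k + 1) - α * φ (N + k) - l| + |α * (φ (N + k) - l / (1 - α))| := abs_add_le _ _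
        _ = |φ (N + k + 1) - α * φ (N + k) - l| + α * |(φ (N + k) - l / (1 - α))| := by
          rw [abs_mul, abs_of_nonneg h0]
        _ ≤ ε / 2 * (1 - α) + α * (α ^ k * |φ N - l / (1 - α)| + ε / 2) := by gcongr
        _ = _ := by ring
  have hp : Tendsto (fun k => α ^ k * |φ N - l / (1 - α)|) atTop (𝓝 0) := by
    simpa using (tendsto_pow_atTop_nhds_zero_of_lt_one h0 h1).mul_const (|φ N - l / (1 - α)|)
  obtain ⟨M, hM⟩ := eventually_atTop.1 (hp.eventually_lt_const (half_pos hε))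
  refine ⟨N + M, fun n hn => ?_⟩
  obtain ⟨k, rfl⟩ := Nat.exists_eq_add_of_le (show N ≤ n by omega)
  rw [Real.dist_eq]
  have := key k
  have := hM k (by omega)
  linarith

lemma aux_seq (α : ℝ) (h0 : 0 ≤ α) (h1 : α < 1 / 3) (φ δ ε : ℕ → ℝ)
    (hφ : ∀ n, 0 ≤ φ n) (hδ : ∀ n, 0 ≤ δ n) (hε : ∀ n, 0 ≤ ε n) (hs : Summable ε)
    (h : ∀ n, φ (n + 2) - (1 + α) * φ (n + 1) + α * φ n + (1 - α) * δ (n + 1) - 2 * α * δ n ≤ ε n) :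
    (∃ l, Tendsto φ atTop (𝓝 l)) ∧ Tendsto δ atTop (𝓝 0) := by
  set μ : ℕ → ℝ := fun n => φ (n + 1) - α * φ n + 2 * α * δ n with hμ
  have hstep : ∀ n, μ (n + 1) + (1 - 3 * α) * δ (n + 1) ≤ μ n + ε n := by
    intro n
    have := h n
    simp only [hμ]
    linarith
  have hc : 0 < 1 - 3 * α := by linarith
  have hsum : ∀ n, μ n + (1 - 3 * α) * ∑ i ∈ Finset.range n, δ (i + 1)
      ≤ μ 0 + ∑ i ∈ Finset.range n, ε i := by
    intro n
    induction n with
    | zero => simp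
    | succ n ih =>
      rw [Finset.sum_range_succ, Finset.sum_range_succ]
      have := hstep n
      linarith
  have hE : ∀ n, ∑ i ∈ Finset.range n, ε i ≤ ∑' i, ε i := fun n =>
    hs.sum_le_tsum _ (fun i _ => hε i)
  have hD : ∀ n, 0 ≤ ∑ i ∈ Finset.range n, δ (i + 1) := fun n =>
    Finset.sum_nonneg fun i _ => hδ _
  set M := |μ 0| + ∑' i, ε i with hM
  have hM0 : 0 ≤ M := add_nonneg (abs_nonneg _) (tsum_nonneg hε)
  have hμM : ∀ n, μ n ≤ M := by
    intro n
    have := hsum n; have := hE n; have := mul_nonneg hc.le (hD n)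
    have := le_abs_self (μ 0)
    linarith
  have hφb : ∀ n, φ n ≤ φ 0 + 2 * M := by
    intro n
    induction n with
    | zero => linarith
    | succ n ih =>
      have h3 := hμM n
      simp only [hμ] at h3
      have h4 : α * φ n ≤ α * (φ 0 + 2 * M) := mul_le_mul_of_nonneg_left ih h0
      have h5 := mul_nonneg h0 (hδ n)
      have := hφ 0
      nlinarith
  have hμl : ∀ n, -(φ 0 + 2 * M) ≤ μ n := by
    intro n
    have h4 : α * φ n ≤ 1 * (φ 0 + 2 * M) :=
      mul_le_mul (by linarith) (hφb n) (hφ n) (by norm_num)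
    have h5 := mul_nonneg h0 (hδ n)
    have := hφ (n + 1)
    simp only [hμ]
    linarith
  have hδs : Summable (fun n => δ (n + 1)) := by
    refine summable_of_sum_range_le (c := (M + (φ 0 + 2 * M)) / (1 - 3 * α)) (fun n => hδ _) ?_
    intro n
    rw [le_div_iff₀ hc]
    have := hsum n; have := hE n; have := hμl n
    have := le_abs_self (μ 0)
    linarith
  have hδ0 : Tendsto δ atTop (𝓝 0) := (tendsto_add_atTop_iff_nat 1).1 hδs.tendsto_atTop_zero
  refine ⟨?_, hδ0⟩
  have hanti : Antitone (fun n => μ n - ∑ i ∈ Finset.range n, ε i) := by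
    refine antitone_nat_of_succ_le fun n => ?_
    rw [Finset.sum_range_succ]
    have := hstep n
    have := mul_nonneg hc.le (hδ (n + 1))
    linarith
  have hlim := tendsto_atTop_ciInf hanti ⟨-(φ 0 + 2 * M) - ∑' i, ε i, by
    rintro _ ⟨n, rfl⟩
    have := hE n; have := hμl n
    simp only
    linarith⟩
  have h6 := (hlim.add hs.hasSum.tendsto_sum_nat).sub (hδ0.const_mul (2 * α))
  refine ⟨_, aux_contr α h0 (by linarith) φ _ (h6.congr fun n => ?_)⟩
  simp only [hμ]
  ring

lemma aux_main {H : Type*} [NormedAddCommGroup H] [InnerProductSpace ℝ H] [CompleteSpace H]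
    (K : Set H) (hK : IsClosed K) (hKc : Convex ℝ K) (f : H → H → ℝ)
    (hfa : ∀ w z, f w z = - f z w)
    (hfc : ∀ y ∈ K, ConvexOn ℝ K (f y))
    (hfl : ∀ y ∈ K, LowerSemicontinuousOn (f y) K)
    (T : H → H) (hT : ∀ w ∈ K, ∀ z ∈ K, 0 ≤ ⟪T w - T z, w - z⟫)
    (hTU : ∀ w ∈ K, ∀ z ∈ K, Filter.limsup (fun t : ℝ =>
      ⟪T (t • z + (1 - t) • w), z - (t • z + (1 - t) • w)⟫)
        (nhdsWithin 0 (Set.Ioi 0)) ≤ ⟪T w, z - w⟫)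
    (SL : Set H) (hSL : ∀ w, w ∈ SL ↔ w ∈ K ∧ ∀ z ∈ K, 0 ≤ f w z)
    (SVL : Set H) (hSVL : ∀ w, w ∈ SVL ↔ w ∈ SL ∧ ∀ z ∈ SL, 0 ≤ ⟪T w, z - w⟫)
    (hne : SVL.Nonempty)
    (α : ℝ) (hα0 : 0 ≤ α) (hα1 : α < 1 / 3)
    (lam beta : ℕ → ℝ) (hlam : ∀ n, 0 < lam n) (hbeta : ∀ n, 0 < beta n)
    (hGC : ∀ w ∈ SVL, ∃ p : H,
      (∀ z ∈ K, 0 ≤ ⟪T w, z - w⟫ + ⟪p, z - w⟫) ∧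
      (∃ F : ℕ → ℝ,
        (∀ n, ∀ y ∈ K, (2 / beta n) * ⟪p, y⟫ + f y w ≤ F n) ∧
        Summable (fun n => lam n * beta n * (F n - (2 / beta n) * ⟪p, w⟫))))
    (x : ℕ → H) (hxK : ∀ n, x n ∈ K)
    (hIPA : ∀ n, ∀ y ∈ K,
      0 ≤ beta (n + 1) * f (x (n + 2)) y + ⟪T (x (n + 2)), y - x (n + 2)⟫ +
        (1 / lam (n + 1)) * ⟪x (n + 2) - (x (n + 1) + α • (x (n + 1) - x n)), y - x (n + 2)⟫)
    (c : ℝ) (hc : 0 < c) (hlc : ∀ᶠ n in Filter.atTop, c ≤ lam n)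
    (hbT : Filter.Tendsto beta Filter.atTop Filter.atTop) :
    ∃ wb ∈ SVL, ∀ z : H, Tendsto (fun n => ⟪x n, z⟫) atTop (𝓝 ⟪wb, z⟫) := by
  have hff : ∀ w, f w w = 0 := fun w => by have := hfa w w; linarith
  -- Fejer type property
  have fej : ∀ u ∈ SVL, (∃ l, Tendsto (fun n => ‖x n - u‖ ^ 2) atTop (𝓝 l)) ∧
      Tendsto (fun n => ‖x (n + 1) - x n‖ ^ 2) atTop (𝓝 0) := by
    intro u hu
    have huL := ((hSVL u).1 hu).1
    obtain ⟨huK, huf⟩ := (hSL u).1 huL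
    obtain ⟨p, hp, F, hF, hFs⟩ := hGC u hu
    have hG0 : ∀ n, 0 ≤ lam n * beta n * (F n - (2 / beta n) * ⟪p, u⟫) := by
      intro n
      have := hF n u huK
      rw [hff] at this
      exact mul_nonneg (mul_nonneg (hlam n).le (hbeta n).le) (by linarith)
    refine aux_seq α hα0 hα1 _ _ (fun n => lam (n+1) * beta (n+1) * (F (n+1) - (2 / beta (n+1)) * ⟪p, u⟫))
      (fun n => by positivity) (fun n => by positivity) (fun n => hG0 _)
      ((summable_nat_add_iff 1).2 hFs) ?_
    intro n
    have hl := hlam (n + 1)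
    have hb := hbeta (n + 1)
    have i1 := hIPA n u huK
    have i2 := hT _ (hxK (n + 2)) u huK
    have i3 := hp _ (hxK (n + 2))
    have i4 := hF (n + 1) _ (hxK (n + 2))
    have i5 := huf _ (hxK (n + 2))
    rw [hfa] at i5
    have i6 : ⟪T (x (n + 2)), u - x (n + 2)⟫ ≤ ⟪p, x (n + 2) - u⟫ := by
      have : ⟪T (x (n + 2)) - T u, x (n + 2) - u⟫
        = - ⟪T (x (n + 2)), u - x (n + 2)⟫ - ⟪T u, x (n + 2) - u⟫ := by
        simp only [inner_sub_left, inner_sub_right]; ring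
      linarith
    have i7 := mul_le_mul_of_nonneg_left i4 hb.le
    have i8 : beta (n+1) * (2 / beta (n+1) * ⟪p, x (n + 2)⟫ + f (x (n+2)) u)
      = 2 * ⟪p, x (n + 2)⟫ + beta (n+1) * f (x (n+2)) u := by field_simp
    have i9 : lam (n+1) * beta (n+1) * (F (n+1) - (2 / beta (n+1)) * ⟪p, u⟫)
      = lam (n+1) * (beta (n+1) * F (n+1) - 2 * ⟪p, u⟫) := by field_simp
    have i10 : beta (n+1) * f (x (n+2)) u ≤ 0 := mul_nonpos_of_nonneg_of_nonpos hb.le (by linarith)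
    have i11 : ⟪p, x (n + 2) - u⟫ = ⟪p, x (n + 2)⟫ - ⟪p, u⟫ := inner_sub_right _ _ _
    set Q := ⟪x (n + 2) - (x (n + 1) + α • (x (n + 1) - x n)), u - x (n + 2)⟫ with hQ
    have i12 : 0 ≤ (beta (n+1) * F (n+1) - 2 * ⟪p, u⟫) + 2 * ((1 / lam (n + 1)) * Q) := by
      linarith
    have i13 := mul_nonneg hl.le i12
    have i14 : lam (n+1) * ((beta (n+1) * F (n+1) - 2 * ⟪p, u⟫) + 2 * ((1 / lam (n + 1)) * Q))
      = lam (n+1) * (beta (n+1) * F (n+1) - 2 * ⟪p, u⟫) + 2 * Q := by field_simp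
    rw [i9]
    rw [i14] at i13
    refine le_trans ?_ (show - (2 * Q) ≤ _ by linarith)
    have e2 : x (n + 2) - (x (n + 1) + α • (x (n + 1) - x n)) =
      (x (n+2) - u) - (1 + α) • (x (n+1) - u) + α • (x n - u) := by module
    have e3 : u - x (n + 2) = -(x (n+2) - u) := by abel
    have e4 : x (n + 1 + 1) - x (n + 1) = (x (n+2) - u) - (x (n+1) - u) := by
      rw [sub_sub_sub_cancel_right]
    have e5 : x (n + 1) - x n = (x (n+1) - u) - (x n - u) := by abel
    rw [hQ, e2, e3, e4, e5]
    generalize x (n+2) - u = a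
    generalize x (n+1) - u = b
    generalize x n - u = d
    have sq : 0 ≤ α * ‖(a - b) - (b - d)‖ ^ 2 := by positivity
    simp only [← real_inner_self_eq_norm_sq, inner_sub_left, inner_sub_right, inner_add_left,
      inner_neg_right, real_inner_smul_left] at sq ⊢
    rw [real_inner_comm a b, real_inner_comm a d, real_inner_comm b d] at *
    nlinarith [sq]
  obtain ⟨u₀, hu₀⟩ := hne
  have hd0 : Tendsto (fun n => ‖x (n + 1) - x n‖) atTop (𝓝 0) := by
    have := (fej u₀ hu₀).2.sqrt
    simpa using this
  obtain ⟨R, hR⟩ : ∃ R, ∀ n, ‖x n‖ ≤ R := by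
    obtain ⟨l, hl⟩ := (fej u₀ hu₀).1
    have := hl.sqrt
    simp only [norm_nonneg, Real.sqrt_sq] at this
    obtain ⟨B, hB⟩ := this.bddAbove_range
    refine ⟨B + ‖u₀‖, fun n => ?_⟩
    have h1 : ‖x n - u₀‖ ≤ B := hB ⟨n, rfl⟩
    have h2 := norm_add_le (x n - u₀) u₀
    rw [sub_add_cancel] at h2
    linarith
  -- the residual
  have hres : ∀ y : H, Tendsto (fun n => (1 / lam (n + 1)) *
      ⟪x (n + 2) - (x (n + 1) + α • (x (n + 1) - x n)), y - x (n + 2)⟫) atTop (𝓝 0) := by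
    intro y
    have hd1 : Tendsto (fun n => ‖x (n + 2) - x (n+1)‖) atTop (𝓝 0) :=
      (tendsto_add_atTop_iff_nat 1).2 hd0
    have h3 : Tendsto (fun n => (1 / c) * ((‖x (n + 2) - x (n+1)‖ + α * ‖x (n + 1) - x n‖) * (‖y‖ + R)))
        atTop (𝓝 0) := by
      simpa using ((hd1.add (hd0.const_mul α)).mul_const (‖y‖ + R)).const_mul (1 / c)
    refine squeeze_zero_norm' ?_ h3
    have := (tendsto_add_atTop_nat 1).eventually hlc
    filter_upwards [this] with n hn
    rw [norm_mul, Real.norm_of_nonneg (one_div_pos.2 (hlam _)).le]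
    have a1 := norm_inner_le_norm (𝕜 := ℝ) (x (n + 2) - (x (n + 1) + α • (x (n + 1) - x n))) (y - x (n + 2))
    have a2 : ‖x (n + 2) - (x (n + 1) + α • (x (n + 1) - x n))‖ ≤
        ‖x (n + 2) - x (n+1)‖ + α * ‖x (n + 1) - x n‖ := by
      rw [← sub_sub]
      refine (norm_sub_le _ _).trans ?_
      rw [norm_smul, Real.norm_of_nonneg hα0]
    have a3 : ‖y - x (n + 2)‖ ≤ ‖y‖ + R := (norm_sub_le _ _).trans (by gcongr; exact hR _)
    refine mul_le_mul (one_div_le_one_div_of_le hc hn) (a1.trans ?_) (norm_nonneg _) (by positivity)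
    exact mul_le_mul a2 a3 (norm_nonneg _) (by positivity)
  have hmon : ∀ w ∈ K, ∀ y ∈ K, ⟪T w, y - w⟫ ≤ ⟪T y, y - w⟫ := by
    intro w hw y hy
    have := hT y hy w hw
    rw [inner_sub_left] at this
    linarith
  -- cluster points
  have clus : ∀ l : Ultrafilter ℕ, (l : Filter ℕ) ≤ atTop → ∀ w,
      (∀ z, Tendsto (fun n => ⟪x (n + 2), z⟫) l (𝓝 ⟪w, z⟫)) → w ∈ SVL := by
    intro l hl w hw
    have hwK : w ∈ K := aux_wlim_mem hK hKc (fun n => x (n + 2)) w (Eventually.of_forall fun n => hxK _) hw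
    have hwL : w ∈ SL := by
      refine (hSL w).2 ⟨hwK, fun y hy => ?_⟩
      rw [hfa, neg_nonneg]
      refine le_of_forall_pos_le_add fun ε hε => ?_
      rw [zero_add]
      have hcl : IsClosed {z ∈ K | f y z ≤ ε} := by
        have := (lowerSemicontinuousOn_iff_preimage_Iic.1 (hfl y hy)) ε
        obtain ⟨C, hC, hCe⟩ := this
        have e : {z ∈ K | f y z ≤ ε} = K ∩ C := by
          rw [← hCe]; rfl
        rw [e]; exact hK.inter hC
      have hcv : Convex ℝ {z ∈ K | f y z ≤ ε} := (hfc y hy).convex_le ε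
      refine (aux_wlim_mem hcl hcv (fun n => x (n + 2)) w ?_ hw).2
      have hb1 : Tendsto (fun n => beta (n + 1)) atTop atTop := hbT.comp (tendsto_add_atTop_nat 1)
      have e1 := hl (hb1.eventually_ge_atTop ((‖T y‖ * (‖y‖ + R) + 1) / ε))
      have e2 := hl ((hres y).eventually_lt_const one_pos)
      filter_upwards [e1, e2] with n h1 h2
      refine ⟨hxK _, ?_⟩
      have i1 := hIPA n y hy
      have i2 := hmon _ (hxK (n + 2)) y hy
      have i3 := real_inner_le_norm (T y) (y - x (n + 2))
      have a3 : ‖y - x (n + 2)‖ ≤ ‖y‖ + R := (norm_sub_le _ _).trans (by gcongr; exact hR _)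
      have i4 : ‖T y‖ * ‖y - x (n + 2)‖ ≤ ‖T y‖ * (‖y‖ + R) := by gcongr
      rw [div_le_iff₀ hε] at h1
      rw [hfa] at i1
      have i5 : beta (n+1) * f y (x (n+2)) ≤ beta (n+1) * ε := by linarith
      exact le_of_mul_le_mul_left i5 (hbeta _)
    refine (hSVL w).2 ⟨hwL, ?_⟩
    have hminty : ∀ y ∈ SL, 0 ≤ ⟪T y, y - w⟫ := by
      intro y hy
      obtain ⟨hyK, hyf⟩ := (hSL y).1 hy
      have t1 : Tendsto (fun n => ⟪T y, y - x (n + 2)⟫ + (1 / lam (n + 1)) *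
          ⟪x (n + 2) - (x (n + 1) + α • (x (n + 1) - x n)), y - x (n + 2)⟫) l
          (𝓝 (⟪T y, y - w⟫ + 0)) := by
        refine Tendsto.add ?_ ((hres y).mono_left hl)
        simp only [inner_sub_right]
        refine tendsto_const_nhds.sub ?_
        have := hw (T y)
        simpa only [real_inner_comm] using this
      rw [add_zero] at t1
      refine ge_of_tendsto' t1 fun n => ?_
      have i1 := hIPA n y hyK
      have i2 := hmon _ (hxK (n + 2)) y hyK
      have i3 := hyf _ (hxK (n + 2))
      rw [hfa] at i1
      have := mul_nonneg (hbeta (n + 1)).le i3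
      linarith
    intro y hy
    obtain ⟨hyK, hyf⟩ := (hSL y).1 hy
    refine le_trans ?_ (hTU w hwK y hyK)
    rw [Filter.limsup_eq]
    refine Real.sInf_nonneg fun a ha => ?_
    have hlt : ∀ᶠ t : ℝ in 𝓝[>] 0, 0 < t ∧ t < 1 :=
      Ioo_mem_nhdsGT one_pos
    obtain ⟨t, hta, ht0, ht1⟩ := (Filter.Eventually.and (show ∀ᶠ n : ℝ in 𝓝[>] 0,
      ⟪T (n • y + (1 - n) • w), y - (n • y + (1 - n) • w)⟫ ≤ a from ha) hlt).exists
    refine le_trans ?_ hta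
    have hm : t • y + (1 - t) • w ∈ SL := by
      refine (hSL _).2 ⟨hKc hyK hwK ht0.le (by linarith) (by ring), fun z hz => ?_⟩
      have c1 := (hfc z hz).2 hyK hwK ht0.le (show 0 ≤ 1 - t by linarith) (by ring)
      have c2 := hyf z hz
      have c3 := ((hSL w).1 hwL).2 z hz
      rw [hfa] at c2 c3 ⊢
      simp only [smul_eq_mul] at c1
      nlinarith
    have h1 := hminty _ hm
    rw [show t • y + (1 - t) • w - w = t • (y - w) by module, real_inner_smul_right] at h1
    rw [show y - (t • y + (1 - t) • w) = (1 - t) • (y - w) by module, real_inner_smul_right]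
    exact mul_nonneg (by linarith) (nonneg_of_mul_nonneg_right h1 ht0)
  -- Opial
  have huniq : ∀ l l' : Ultrafilter ℕ, (l : Filter ℕ) ≤ atTop → (l' : Filter ℕ) ≤ atTop → ∀ w w',
      (∀ z, Tendsto (fun n => ⟪x (n + 2), z⟫) l (𝓝 ⟪w, z⟫)) →
      (∀ z, Tendsto (fun n => ⟪x (n + 2), z⟫) l' (𝓝 ⟪w', z⟫)) → w = w' := by
    intro l l' hl hl' w w' hw hw'
    obtain ⟨a, ha⟩ := (fej w (clus l hl w hw)).1
    obtain ⟨b, hb⟩ := (fej w' (clus l' hl' w' hw')).1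
    have h1 := (tendsto_add_atTop_iff_nat 2).2 (ha.sub hb)
    have h2 : Tendsto (fun n => ⟪x (n + 2), w - w'⟫) atTop
        (𝓝 (((a - b) - ‖w‖ ^ 2 + ‖w'‖ ^ 2) / (-2))) := by
      refine (((h1.sub_const (‖w‖ ^ 2)).add_const (‖w'‖ ^ 2)).div_const (-2)).congr fun n => ?_
      rw [norm_sub_sq_real, norm_sub_sq_real, inner_sub_right]
      ring
    have h3 := tendsto_nhds_unique (hw (w - w')) (h2.mono_left hl)
    have h4 := tendsto_nhds_unique (hw' (w - w')) (h2.mono_left hl')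
    have h5 : ⟪w - w', w - w'⟫ = 0 := by rw [inner_sub_left, h3, h4, sub_self]
    exact sub_eq_zero.1 (inner_self_eq_zero.1 h5)
  have hlim := fun l : Ultrafilter ℕ => aux_ultra l (fun n => x (n + 2)) R (fun n => hR _)
  obtain ⟨w, hw⟩ := hlim (Ultrafilter.of atTop)
  refine ⟨w, clus _ (Ultrafilter.of_le _) w hw, fun z => ?_⟩
  rw [← tendsto_add_atTop_iff_nat 2, tendsto_iff_ultrafilter]
  intro l hl
  obtain ⟨w', hw'⟩ := hlim l
  rw [huniq _ l (Ultrafilter.of_le _) hl w w' hw hw']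
  exact hw' z

end Aux

theorem stmt15 {H₁ H₂ : Type*}
    [NormedAddCommGroup H₁] [InnerProductSpace ℝ H₁] [CompleteSpace H₁]
    [NormedAddCommGroup H₂] [InnerProductSpace ℝ H₂] [CompleteSpace H₂]
    (U : Set H₁) (V : Set H₂) (hUne : U.Nonempty) (hVne : V.Nonempty)
    (hUcl : IsClosed U) (hVcl : IsClosed V) (hUcv : Convex ℝ U) (hVcv : Convex ℝ V)
    (L : H₁ → H₂ → ℝ)
    (hLconv : ∀ v ∈ V, ConvexOn ℝ U (fun u => L u v) ∧
      LowerSemicontinuousOn (fun u => L u v) U)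
    (hLconc : ∀ u ∈ U, ConvexOn ℝ V (fun v => -L u v) ∧
      LowerSemicontinuousOn (fun v => -L u v) V)
    (A : H₁ → H₁) (B : H₂ → H₂)
    (hAmono : ∀ u ∈ U, ∀ u' ∈ U, 0 ≤ ⟪A u - A u', u - u'⟫)
    (hBmono : ∀ v ∈ V, ∀ v' ∈ V, 0 ≤ ⟪B v - B v', v - v'⟫)
    (f g : H₁ × H₂ → H₁ × H₂ → ℝ)
    (hf : ∀ w z : H₁ × H₂, f w z = L z.1 w.2 - L w.1 z.2)
    (hg : ∀ w z : H₁ × H₂, g w z = ⟪A w.1, z.1 - w.1⟫ + ⟪B w.2, z.2 - w.2⟫)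
    (hfUHC : ∀ w ∈ U ×ˢ V, ∀ z ∈ U ×ˢ V, ∀ w' ∈ U ×ˢ V,
      Filter.limsup (fun t : ℝ => f (t • w' + (1 - t) • w) z)
        (nhdsWithin 0 (Set.Ioi 0)) ≤ f w z)
    (hgUHC : ∀ w ∈ U ×ˢ V, ∀ z ∈ U ×ˢ V, ∀ w' ∈ U ×ˢ V,
      Filter.limsup (fun t : ℝ => g (t • w' + (1 - t) • w) z)
        (nhdsWithin 0 (Set.Ioi 0)) ≤ g w z)
    -- `SL` is the set of saddle points of `L`, i.e. the solution set `S_f` of the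
    -- equilibrium problem for `f` on `K = U ×ˢ V`.
    (SL : Set (H₁ × H₂)) (hSL : SL = {w ∈ U ×ˢ V | ∀ z ∈ U ×ˢ V, 0 ≤ f w z})
    -- `SVL` is the upper-level solution set.
    (SVL : Set (H₁ × H₂))
    (hSVL : SVL = {w ∈ SL | ∀ z ∈ SL, 0 ≤ ip ((A w.1, B w.2) : H₁ × H₂) (z - w)})
    (hSVLne : SVL.Nonempty)
    (α : ℝ) (hα0 : 0 ≤ α) (hα1 : α < 1 / 3)
    (lam beta : ℕ → ℝ) (hlam : ∀ n, 0 < lam n) (hbeta : ∀ n, 0 < beta n)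
    -- for every element of `SVL` there is a normal-cone element for which the geometric
    -- condition (GC) holds
    (hGC : ∀ w ∈ SVL, ∃ pq : H₁ × H₂,
      (∀ z ∈ SL, ip pq (z - w) ≤ 0) ∧
      (∀ z ∈ U ×ˢ V, 0 ≤ g w z + ip pq (z - w)) ∧
      (∃ F : ℕ → ℝ,
        (∀ n, IsLUB {r : ℝ | ∃ y ∈ U ×ˢ V, r = ip ((2 / beta n) • pq) y + f y w} (F n)) ∧
        Summable (fun n => lam n * beta n * (F n - (2 / beta n) * ip pq w))))
    (x : ℕ → H₁ × H₂) (hxK : ∀ n, x n ∈ U ×ˢ V)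
    (hIPA : ∀ n, 1 ≤ n → ∀ y ∈ U ×ˢ V,
      0 ≤ beta n * f (x (n + 1)) y + g (x (n + 1)) y +
        (1 / lam n) * ip (x (n + 1) - (x n + α • (x n - x (n - 1)))) (y - x (n + 1)))
    (hlaminf : ∃ c > (0 : ℝ), ∀ᶠ n in Filter.atTop, c ≤ lam n)
    (hbetaTop : Filter.Tendsto beta Filter.atTop Filter.atTop) :
    ∃ wb ∈ SVL, ∀ z : H₁ × H₂,
      Filter.Tendsto (fun n => ip (x n) z) Filter.atTop (nhds (ip wb z)) := by
  subst hSL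
  subst hSVL
  obtain ⟨c, hc, hlc⟩ := hlaminf
  let e : WithLp 2 (H₁ × H₂) → H₁ × H₂ := WithLp.ofLp
  have hec : Continuous e := WithLp.prod_continuous_ofLp 2 H₁ H₂
  have hin : ∀ a b : WithLp 2 (H₁ × H₂), ⟪a, b⟫ = ip (e a) (e b) := fun a b => rfl
  obtain ⟨wb, hwb, hlim⟩ := aux_main (H := WithLp 2 (H₁ × H₂)) (e ⁻¹' (U ×ˢ V))
    ((hUcl.prod hVcl).preimage hec)
    (by
      intro a ha b hb s t hs ht hst
      exact (hUcv.prod hVcv) ha hb hs ht hst)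
    (fun a b => f (e a) (e b))
    (fun a b => by simp only [hf]; ring)
    (by
      intro y hy
      refine ⟨?_, ?_⟩
      · intro a ha b hb s t hs ht hst
        exact (hUcv.prod hVcv) ha hb hs ht hst
      · intro a ha b hb s t hs ht hst
        have h1 := (hLconv (e y).2 hy.2).1.2 ha.1 hb.1 hs ht hst
        have h2 := (hLconc (e y).1 hy.1).1.2 ha.2 hb.2 hs ht hst
        simp only [hf, smul_eq_mul] at h1 h2 ⊢
        have e1 : (e (s • a + t • b)).1 = s • (e a).1 + t • (e b).1 := rfl
        have e2 : (e (s • a + t • b)).2 = s • (e a).2 + t • (e b).2 := rfl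
        rw [e1, e2]
        linarith)
    (by
      intro y hy
      have h1 : LowerSemicontinuousOn (fun a => L (e a).1 (e y).2) (e ⁻¹' (U ×ˢ V)) :=
        (hLconv (e y).2 hy.2).2.comp (continuous_fst.comp hec).continuousOn (fun a ha => ha.1)
      have h2 : LowerSemicontinuousOn (fun a => -L (e y).1 (e a).2) (e ⁻¹' (U ×ˢ V)) :=
        (hLconc (e y).1 hy.1).2.comp (continuous_snd.comp hec).continuousOn (fun a ha => ha.2)
      have h3 := h1.add h2
      simp only [hf, sub_eq_add_neg]
      exact h3)
    (fun a => WithLp.toLp 2 (A (e a).1, B (e a).2))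
    (by
      intro w hw z hz
      exact add_nonneg (hAmono _ hw.1 _ hz.1) (hBmono _ hw.2 _ hz.2))
    (by
      intro w hw z hz
      have := hgUHC (e w) hw (e z) hz (e z) hz
      simp only [hg] at this
      exact this)
    (e ⁻¹' {w ∈ U ×ˢ V | ∀ z ∈ U ×ˢ V, 0 ≤ f w z})
    (by
      intro w
      exact ⟨fun h => ⟨h.1, fun z hz => h.2 _ hz⟩, fun h => ⟨h.1, fun z hz => h.2 (WithLp.toLp 2 z) hz⟩⟩)
    (e ⁻¹' {w ∈ {w ∈ U ×ˢ V | ∀ z ∈ U ×ˢ V, 0 ≤ f w z} |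
      ∀ z ∈ {w ∈ U ×ˢ V | ∀ z ∈ U ×ˢ V, 0 ≤ f w z},
        0 ≤ ip ((A w.1, B w.2) : H₁ × H₂) (z - w)})
    (by
      intro w
      exact ⟨fun h => ⟨h.1, fun z hz => h.2 _ hz⟩, fun h => ⟨h.1, fun z hz => h.2 (WithLp.toLp 2 z) hz⟩⟩)
    (by
      obtain ⟨w, hw⟩ := hSVLne
      exact ⟨WithLp.toLp 2 w, hw⟩)
    α hα0 hα1 lam beta hlam hbeta
    (by
      intro w hw
      obtain ⟨pq, -, h2, F, hF, hs⟩ := hGC (e w) hw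
      refine ⟨WithLp.toLp 2 pq, ?_, F, ?_, hs⟩
      · intro z hz
        have := h2 (e z) hz
        rw [hg] at this
        exact this
      · intro n y hy
        have := (hF n).1 ⟨e y, hy, rfl⟩
        have h3 : ip ((2 / beta n) • pq) (e y) = (2 / beta n) * ip pq (e y) := by
          simp only [ip, Prod.smul_fst, Prod.smul_snd, real_inner_smul_left]
          ring
        rw [h3] at this
        exact this)
    (fun n => WithLp.toLp 2 (x n)) hxK
    (by
      intro n y hy
      have := hIPA (n + 1) (by omega) (e y) hy
      rw [hg] at this
      exact this)
    c hc hlc hbetaTop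
  exact ⟨e wb, hwb, fun z => hlim (WithLp.toLp 2 z)⟩
end
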